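/- Let λ < 0 and let b_n > 0 solve π|λ|(1+λ²) b_n² exp((1+λ²)b_n²/2) = n, with a_n = ((1+λ²)b_n)^{-1}. Then for every real x, n(1 - F_λ(a_n x + b_n)) → e^{-x} as n → ∞, and hence F_λ^n(a_n x + b_n) → exp(-e^{-x}). -/

import Mathlib

open Real MeasureTheory Filter

noncomputable def stdPhi (x : ℝ) : ℝ := (Real.sqrt (2 * Real.pi))⁻¹ * Real.exp (-x ^ 2 / 2)

noncomputable def stdCdf (x : ℝ) : ℝ := ∫ t in Set.Iic x, stdPhi t

noncomputable def snCdf (l x : ℝ) : ℝ := ∫ t in Set.Iic x, 2 * stdPhi t * stdCdf (l * t)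

lemma hasDerivAt_integral_Iic {f : ℝ → ℝ} (hf : Continuous f) (hi : Integrable f) (x : ℝ) :
    HasDerivAt (fun y => ∫ t in Set.Iic y, f t) (f x) x := by
  have h : (fun y => ∫ t in Set.Iic y, f t)
      = fun y => (∫ t in Set.Iic 0, f t) + ∫ t in (0 : ℝ)..y, f t := by
    funext y
    rw [← intervalIntegral.integral_Iic_sub_Iic hi.integrableOn hi.integrableOn]
    ring
  rw [h]
  exact (hf.integral_hasStrictDerivAt 0 x).hasDerivAt.const_add _

lemma tendsto_integral_Iic_atTop {f : ℝ → ℝ} (hi : Integrable f) :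
    Tendsto (fun y => ∫ t in Set.Iic y, f t) atTop (nhds (∫ t, f t)) :=
  (aecover_Iic tendsto_id).integral_tendsto_of_countably_generated hi

lemma stdPhi_eq_gaussianPDFReal : stdPhi = ProbabilityTheory.gaussianPDFReal 0 1 := by
  funext x
  simp [stdPhi, ProbabilityTheory.gaussianPDFReal]

lemma stdPhi_pos (x : ℝ) : 0 < stdPhi x := by
  unfold stdPhi
  positivity

lemma stdPhi_neg (x : ℝ) : stdPhi (-x) = stdPhi x := by
  simp [stdPhi]

lemma continuous_stdPhi : Continuous stdPhi := by
  unfold stdPhi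
  fun_prop

lemma integrable_stdPhi : Integrable stdPhi := by
  rw [stdPhi_eq_gaussianPDFReal]
  exact ProbabilityTheory.integrable_gaussianPDFReal 0 1

lemma integral_stdPhi : ∫ t, stdPhi t = 1 := by
  rw [stdPhi_eq_gaussianPDFReal]
  exact ProbabilityTheory.integral_gaussianPDFReal_eq_one 0 one_ne_zero

lemma stdPhi_mul_stdPhi_mul (l x : ℝ) :
    stdPhi x * stdPhi (l * x) = (2 * π)⁻¹ * rexp (-((1 + l ^ 2) * x ^ 2 / 2)) := by
  have h : (√(2 * π))⁻¹ * (√(2 * π))⁻¹ = (2 * π)⁻¹ := by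
    rw [← mul_inv, Real.mul_self_sqrt (by positivity)]
  unfold stdPhi
  rw [mul_mul_mul_comm, h, ← Real.exp_add]
  congr 2
  ring

lemma hasDerivAt_stdPhi (x : ℝ) : HasDerivAt stdPhi (-x * stdPhi x) x := by
  have h : HasDerivAt (fun x : ℝ => -x ^ 2 / 2) (-x) x :=
    ((hasDerivAt_pow 2 x).neg.div_const 2).congr_deriv (by norm_num; ring)
  refine (h.exp.const_mul (√(2 * π))⁻¹).congr_deriv ?_
  unfold stdPhi
  ring

lemma tendsto_exp_neg_mul_sq {c : ℝ} (hc : 0 < c) :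
    Tendsto (fun x : ℝ => rexp (-(c * x ^ 2 / 2))) atTop (nhds 0) :=
  Real.tendsto_exp_neg_atTop_nhds_zero.comp
    (((tendsto_pow_atTop two_ne_zero).const_mul_atTop hc).atTop_div_const two_pos)

lemma tendsto_stdPhi_atTop : Tendsto stdPhi atTop (nhds 0) := by
  have h := (tendsto_exp_neg_mul_sq one_pos).const_mul (√(2 * π))⁻¹
  rw [mul_zero] at h
  refine h.congr fun x => ?_
  unfold stdPhi
  congr 2
  ring

lemma hasDerivAt_stdCdf (x : ℝ) : HasDerivAt stdCdf (stdPhi x) x :=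
  hasDerivAt_integral_Iic continuous_stdPhi integrable_stdPhi x

lemma continuous_stdCdf : Continuous stdCdf :=
  continuous_iff_continuousAt.2 fun x => (hasDerivAt_stdCdf x).continuousAt

lemma tendsto_stdCdf_atTop : Tendsto stdCdf atTop (nhds 1) := by
  have h := tendsto_integral_Iic_atTop integrable_stdPhi
  rwa [integral_stdPhi] at h

lemma stdCdf_neg (x : ℝ) : stdCdf (-x) = 1 - stdCdf x := by
  have h1 : stdCdf (-x) = ∫ t in Set.Ioi x, stdPhi t := by
    have h := integral_comp_neg_Iic (-x) stdPhi
    simp only [stdPhi_neg, neg_neg] at h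
    exact h
  have h2 := intervalIntegral.integral_Iic_add_Ioi (b := x) integrable_stdPhi.integrableOn
    integrable_stdPhi.integrableOn
  rw [integral_stdPhi] at h2
  rw [h1, stdCdf, ← h2]
  ring

lemma stdCdf_nonneg (x : ℝ) : 0 ≤ stdCdf x :=
  setIntegral_nonneg measurableSet_Iic fun t _ => (stdPhi_pos t).le

lemma stdCdf_le_one (x : ℝ) : stdCdf x ≤ 1 := by
  have h := stdCdf_nonneg (-x)
  rw [stdCdf_neg] at h
  linarith

/-- Mills' ratio for the standard normal distribution. -/
lemma tendsto_mills_ratio :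
    Tendsto (fun s => (1 - stdCdf s) / (stdPhi s / s)) atTop (nhds 1) := by
  refine HasDerivAt.lhopital_zero_atTop (f' := fun s => -stdPhi s)
    (g' := fun s => (-s * stdPhi s * s - stdPhi s * 1) / s ^ 2) ?_ ?_ ?_ ?_ ?_ ?_
  · exact Eventually.of_forall fun s => (hasDerivAt_stdCdf s).const_sub 1
  · filter_upwards [eventually_ne_atTop 0] with s hs
    exact (hasDerivAt_stdPhi s).div (hasDerivAt_id s) hs
  · filter_upwards [eventually_gt_atTop 0] with s hs
    have h := stdPhi_pos s
    refine div_ne_zero (ne_of_lt ?_) (by positivity)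
    nlinarith [mul_pos (mul_pos hs hs) h]
  · simpa using tendsto_stdCdf_atTop.const_sub 1
  · exact tendsto_stdPhi_atTop.div_atTop tendsto_id
  · have h : Tendsto (fun s : ℝ => 1 - (s ^ 2 + 1)⁻¹) atTop (nhds (1 - 0)) :=
      (tendsto_inv_atTop_zero.comp (tendsto_atTop_add_const_right _ 1
        (tendsto_pow_atTop two_ne_zero))).const_sub 1
    rw [sub_zero] at h
    refine h.congr' ?_
    filter_upwards [eventually_gt_atTop 0] with s hs
    have hp := (stdPhi_pos s).ne'
    have hd : -s * stdPhi s * s - stdPhi s * 1 = -(stdPhi s * (s ^ 2 + 1)) := by ring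
    rw [hd]
    have : s ^ 2 + 1 ≠ 0 := by positivity
    field_simp
    ring

lemma continuous_skewNormal_pdf (l : ℝ) :
    Continuous fun t => 2 * stdPhi t * stdCdf (l * t) :=
  (continuous_const.mul continuous_stdPhi).mul
    (continuous_stdCdf.comp (continuous_const.mul continuous_id))

lemma integrable_skewNormal_pdf (l : ℝ) :
    Integrable fun t => 2 * stdPhi t * stdCdf (l * t) := by
  refine (integrable_stdPhi.const_mul 2).mono (continuous_skewNormal_pdf l).aestronglyMeasurable
    (Eventually.of_forall fun t => ?_)
  rw [norm_mul]
  refine mul_le_of_le_one_right (norm_nonneg _) ?_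
  rw [Real.norm_of_nonneg (stdCdf_nonneg _)]
  exact stdCdf_le_one _

lemma integral_skewNormal_pdf (l : ℝ) : ∫ t, 2 * stdPhi t * stdCdf (l * t) = 1 := by
  have h1 : ∫ t, 2 * stdPhi t * stdCdf (l * t)
      = ∫ t, (2 * stdPhi t - 2 * stdPhi t * stdCdf (l * t)) := by
    rw [← integral_neg_eq_self fun t => 2 * stdPhi t * stdCdf (l * t)]
    refine integral_congr_ae (Eventually.of_forall fun t => ?_)
    simp only [mul_neg, stdPhi_neg, stdCdf_neg]
    ring
  rw [integral_sub (integrable_stdPhi.const_mul 2) (integrable_skewNormal_pdf l),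
    integral_const_mul, integral_stdPhi] at h1
  linarith

lemma tendsto_snCdf_atTop (l : ℝ) : Tendsto (snCdf l) atTop (nhds 1) := by
  have h := tendsto_integral_Iic_atTop (integrable_skewNormal_pdf l)
  rwa [integral_skewNormal_pdf] at h

/-- Tail asymptotics of the skew-normal distribution with negative shape parameter. -/
lemma tendsto_snCdf_tail_ratio {l : ℝ} (hl : l < 0) :
    Tendsto (fun y => (1 - snCdf l y) /
      (rexp (-((1 + l ^ 2) * y ^ 2 / 2)) / (π * |l| * (1 + l ^ 2) * y ^ 2))) atTop (nhds 1) := by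
  have hl' : 0 < -l := neg_pos.2 hl
  have hc : 0 < 1 + l ^ 2 := by positivity
  rw [abs_of_neg hl]
  have hK : 0 < π * -l * (1 + l ^ 2) := by positivity
  refine HasDerivAt.lhopital_zero_atTop (f' := fun y => -(2 * stdPhi y * stdCdf (l * y)))
    (g' := fun y => -(rexp (-((1 + l ^ 2) * y ^ 2 / 2)) * ((1 + l ^ 2) * y ^ 2 + 2)
      / (π * -l * (1 + l ^ 2) * y ^ 3))) ?_ ?_ ?_ ?_ ?_ ?_
  · exact Eventually.of_forall fun y => (hasDerivAt_integral_Iic (continuous_skewNormal_pdf l)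
      (integrable_skewNormal_pdf l) y).const_sub 1
  · filter_upwards [eventually_gt_atTop 0] with y hy
    have h1 : HasDerivAt (fun y : ℝ => -((1 + l ^ 2) * y ^ 2 / 2)) (-((1 + l ^ 2) * y)) y :=
      (((hasDerivAt_pow 2 y).const_mul (1 + l ^ 2)).div_const 2).neg.congr_deriv
        (by norm_num; ring)
    have h2 : HasDerivAt (fun y : ℝ => π * -l * (1 + l ^ 2) * y ^ 2)
        (π * -l * (1 + l ^ 2) * (2 * y)) y :=
      ((hasDerivAt_pow 2 y).const_mul (π * -l * (1 + l ^ 2))).congr_deriv (by norm_num)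
    refine (h1.exp.div h2 (by positivity)).congr_deriv ?_
    generalize π * -l * (1 + l ^ 2) = K at *
    field_simp
    ring
  · filter_upwards [eventually_gt_atTop 0] with y hy
    exact neg_ne_zero.2 (by positivity)
  · simpa using (tendsto_snCdf_atTop l).const_sub 1
  · exact (tendsto_exp_neg_mul_sq hc).div_atTop
      ((tendsto_pow_atTop two_ne_zero).const_mul_atTop hK)
  · have h1 := tendsto_mills_ratio.comp (tendsto_id.const_mul_atTop hl')
    have h2 : Tendsto (fun y : ℝ => 1 - 2 / ((1 + l ^ 2) * y ^ 2 + 2)) atTop (nhds (1 - 0)) :=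
      (tendsto_const_nhds.div_atTop (tendsto_atTop_add_const_right _ 2
        ((tendsto_pow_atTop two_ne_zero).const_mul_atTop hc))).const_sub 1
    have h3 := h1.mul h2
    rw [sub_zero, mul_one] at h3
    refine h3.congr' ?_
    filter_upwards [eventually_gt_atTop 0] with y hy
    have hp := stdPhi_mul_stdPhi_mul (-l) y
    rw [neg_sq] at hp
    have hE : rexp (-((1 + l ^ 2) * y ^ 2 / 2)) = 2 * π * (stdPhi y * stdPhi (-l * y)) := by
      rw [hp]
      field_simp
    have hs : stdCdf (l * y) = 1 - stdCdf (-l * y) := by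
      rw [← stdCdf_neg]
      congr 1
      ring
    have hp1 := (stdPhi_pos y).ne'
    have hp2 := (stdPhi_pos (-l * y)).ne'
    have hq : (1 + l ^ 2) * y ^ 2 + 2 ≠ 0 := by positivity
    rw [hE, hs]
    simp only [Function.comp_apply, id]
    generalize 1 + l ^ 2 = c at *
    generalize -l = k at *
    generalize stdPhi (k * y) = p at *
    generalize stdCdf (k * y) = q at *
    field_simp
    ring

theorem stmt_9 (l : ℝ) (hl : l < 0) (b : ℕ → ℝ)
    (hb : ∀ n : ℕ, 1 ≤ n → 0 < b n ∧
      Real.pi * |l| * (1 + l ^ 2) * (b n) ^ 2 * Real.exp ((1 + l ^ 2) * (b n) ^ 2 / 2) = n)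
    (x : ℝ) :
    Tendsto (fun n : ℕ => (n : ℝ) * (1 - snCdf l (((1 + l ^ 2) * b n)⁻¹ * x + b n))) atTop
      (nhds (Real.exp (-x))) ∧
    Tendsto (fun n : ℕ => (snCdf l (((1 + l ^ 2) * b n)⁻¹ * x + b n)) ^ n) atTop
      (nhds (Real.exp (-Real.exp (-x)))) := by
  have hc : 0 < 1 + l ^ 2 := by positivity
  have hl' : 0 < |l| := abs_pos.2 hl.ne
  have hbt : Tendsto b atTop atTop := by
    refine tendsto_atTop.2 fun M => ?_
    filter_upwards [eventually_ge_atTop 1, tendsto_natCast_atTop_atTop.eventually_gt_atTop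
      (π * |l| * (1 + l ^ 2) * M ^ 2 * rexp ((1 + l ^ 2) * M ^ 2 / 2))] with n hn hM
    obtain ⟨h0, h1⟩ := hb n hn
    by_contra! h
    rw [← h1] at hM
    refine hM.not_ge ?_
    gcongr
  have hinv : Tendsto (fun n => (b n)⁻¹) atTop (nhds 0) := tendsto_inv_atTop_zero.comp hbt
  have hyt : Tendsto (fun n => ((1 + l ^ 2) * b n)⁻¹ * x + b n) atTop atTop := by
    refine Tendsto.add_atTop (C := 0) ?_ hbt
    have h := (hinv.const_mul (1 + l ^ 2)⁻¹).mul_const x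
    simpa [mul_inv, mul_comm, mul_left_comm, mul_assoc] using h
  have hnorm : Tendsto (fun n : ℕ => ((1 + (1 + l ^ 2)⁻¹ * x * (b n)⁻¹ ^ 2) ^ 2)⁻¹ *
      rexp (-x - (2 * (1 + l ^ 2))⁻¹ * x ^ 2 * (b n)⁻¹ ^ 2)) atTop (nhds (rexp (-x))) := by
    have h2 := hinv.pow 2
    have h3 := (((h2.const_mul ((1 + l ^ 2)⁻¹ * x)).const_add 1).pow 2).inv₀ (by norm_num)
    have h4 := ((h2.const_mul ((2 * (1 + l ^ 2))⁻¹ * x ^ 2)).const_sub (-x)).rexp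
    simpa using h3.mul h4
  have hmain : Tendsto (fun n : ℕ => (n : ℝ) *
      (1 - snCdf l (((1 + l ^ 2) * b n)⁻¹ * x + b n))) atTop (nhds (rexp (-x))) := by
    have h := ((tendsto_snCdf_tail_ratio hl).comp hyt).mul hnorm
    rw [one_mul] at h
    refine h.congr' ?_
    filter_upwards [eventually_ge_atTop 1, hyt.eventually_gt_atTop 0] with n hn hy
    obtain ⟨h0, h1⟩ := hb n hn
    have hsq : (((1 + l ^ 2) * b n)⁻¹ * x + b n) ^ 2
        = b n ^ 2 * (1 + (1 + l ^ 2)⁻¹ * x * (b n)⁻¹ ^ 2) ^ 2 := by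
      field_simp
      ring
    have hexp : rexp (-x - (2 * (1 + l ^ 2))⁻¹ * x ^ 2 * (b n)⁻¹ ^ 2)
        = rexp ((1 + l ^ 2) * (b n) ^ 2 / 2) *
          rexp (-((1 + l ^ 2) * (((1 + l ^ 2) * b n)⁻¹ * x + b n) ^ 2 / 2)) := by
      rw [← Real.exp_add]
      congr 1
      field_simp
      ring
    have hw : 1 + (1 + l ^ 2)⁻¹ * x * (b n)⁻¹ ^ 2 ≠ 0 := by
      intro hw
      rw [hw] at hsq
      have := pow_pos hy 2
      rw [hsq] at this
      norm_num at this
    rw [hexp, ← h1]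
    simp only [Function.comp_apply]
    generalize 1 - snCdf l (((1 + l ^ 2) * b n)⁻¹ * x + b n) = S
    have hE := (Real.exp_pos (-((1 + l ^ 2) * (((1 + l ^ 2) * b n)⁻¹ * x + b n) ^ 2 / 2))).ne'
    generalize rexp (-((1 + l ^ 2) * (((1 + l ^ 2) * b n)⁻¹ * x + b n) ^ 2 / 2)) = E at *
    rw [hsq]
    generalize 1 + (1 + l ^ 2)⁻¹ * x * (b n)⁻¹ ^ 2 = w at *
    generalize rexp ((1 + l ^ 2) * (b n) ^ 2 / 2) = D at *
    field_simp
  refine ⟨hmain, ?_⟩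
  have h := Real.tendsto_one_add_pow_exp_of_tendsto
    (g := fun n => -(1 - snCdf l (((1 + l ^ 2) * b n)⁻¹ * x + b n))) (t := -rexp (-x))
    (by simpa only [mul_neg] using hmain.neg)
  refine h.congr fun n => ?_
  congr 1
  ring
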